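/- There is a constant C > 0, independent of T and ψ, such that for every T > 0 and every smooth function ψ on [0,T]×ℝ³ which is Schwartz in the space variable for each t, one has ‖∇²ψ‖_{L⁴_T(L⁴(ℝ³))} ≤ C ‖∇_h∇ψ‖_{L²_T(H¹(ℝ³))}^{1/2} ‖∇ψ‖_{L^∞_T(H²(ℝ³))}^{1/2}, where ∇²ψ denotes the full Hessian of ψ in the space variables. -/

import Mathlib

open MeasureTheory Real Set Filter
open scoped ENNReal NNReal

noncomputable section

/-- Spatial points of `ℝ³`. -/
abbrev Pt : Type := Fin 3 → ℝ

/-- Partial derivative in the `i`-th coordinate direction. -/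
def pd (i : Fin 3) (f : Pt → ℝ) : Pt → ℝ := fun x => fderiv ℝ f x (Pi.single i 1)

/-- Iterated partial derivative `∂^α` for a multi-index `α`. -/
def pdM (α : Fin 3 → ℕ) (f : Pt → ℝ) : Pt → ℝ :=
  (pd 0)^[α 0] ((pd 1)^[α 1] ((pd 2)^[α 2] f))

/-- Multi-indices of total degree at most `k`. -/
def midx (k : ℕ) : Finset (Fin 3 → ℕ) :=
  (Fintype.piFinset fun _ => Finset.range (k + 1)).filter fun α => ∑ i, α i ≤ k

/-- The `H^k` inner product `(f|g)_{H^k} = ∑_{|α| ≤ k} ∫ ∂^α f ∂^α g`. -/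
def hInner (k : ℕ) (f g : Pt → ℝ) : ℝ := ∑ α ∈ midx k, ∫ x : Pt, pdM α f x * pdM α g x

/-- The squared `H^k` norm. -/
def hSq (k : ℕ) (f : Pt → ℝ) : ℝ := hInner k f f

/-- The squared `L²` norm. -/
def l2Sq (f : Pt → ℝ) : ℝ := ∫ x : Pt, (f x) ^ 2

/-- The Laplacian. -/
def lapl (f : Pt → ℝ) : Pt → ℝ := fun x => ∑ i, pd i (pd i f) x

/-- Horizontal directions. -/
def hIdx : Finset (Fin 3) := {0, 1}

/-- `L^∞` norm in time over `[0,T]` of a (nonnegative) function of time. -/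
def supT (T : ℝ) (g : ℝ → ℝ) : ℝ := sSup (g '' Icc 0 T)

/-- `L²` norm in time over `[0,T]`. -/
def l2T (T : ℝ) (g : ℝ → ℝ) : ℝ := Real.sqrt (∫ t in (0:ℝ)..T, (g t) ^ 2)

/-- `L⁴` norm in time over `[0,T]`. -/
def l4T (T : ℝ) (g : ℝ → ℝ) : ℝ := (∫ t in (0:ℝ)..T, (g t) ^ 4) ^ ((1:ℝ)/4)

/-- A function is Schwartz: smooth with all derivatives rapidly decaying. -/
def IsSchwartz (f : Pt → ℝ) : Prop :=
  ContDiff ℝ (⊤ : ℕ∞) f ∧ ∀ k n : ℕ, ∃ C : ℝ, ∀ x, ‖x‖ ^ k * ‖iteratedFDeriv ℝ n f x‖ ≤ C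

/-- Smoothness of `f` jointly in `(t,x)` on `s ×ˢ ℝ³`. -/
def SmoothOn2 (s : Set ℝ) (f : ℝ → Pt → ℝ) : Prop :=
  ContDiffOn ℝ (⊤ : ℕ∞) (fun q : ℝ × Pt => f q.1 q.2) (s ×ˢ (univ : Set Pt))

/-- `‖∇f‖_{H^k}²`. -/
def gradHSq (k : ℕ) (f : Pt → ℝ) : ℝ := ∑ i, hSq k (pd i f)

/-- `‖∇_h∇f‖_{H^k}²`. -/
def gradHHSq (k : ℕ) (f : Pt → ℝ) : ℝ := ∑ i ∈ hIdx, ∑ j, hSq k (pd i (pd j f))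

/-- `‖v‖_{H^k}²` for a vector field. -/
def vecHSq (k : ℕ) (v : Fin 3 → Pt → ℝ) : ℝ := ∑ j, hSq k (v j)

/-- `‖∇v‖_{H^k}²` for a vector field. -/
def gradVecHSq (k : ℕ) (v : Fin 3 → Pt → ℝ) : ℝ := ∑ j, gradHSq k (v j)

/-- `B_T²`. -/
def BTsq (T : ℝ) (ψ : ℝ → Pt → ℝ) (v : Fin 3 → ℝ → Pt → ℝ) : ℝ :=
  (supT T fun t => Real.sqrt (vecHSq 2 fun j => v j t)) ^ 2
  + (supT T fun t => Real.sqrt (gradHSq 2 (ψ t))) ^ 2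
  + (l2T T fun t => Real.sqrt (gradVecHSq 2 fun j => v j t)) ^ 2
  + (l2T T fun t => Real.sqrt (gradHHSq 1 (ψ t))) ^ 2

/-- `B_T`. -/
def BT (T : ℝ) (ψ : ℝ → Pt → ℝ) (v : Fin 3 → ℝ → Pt → ℝ) : ℝ := Real.sqrt (BTsq T ψ v)

/-- The transport equation `∂_tψ + v·∇ψ + v₃ = 0` on `s × ℝ³`. -/
def TransportEq (s : Set ℝ) (ψ : ℝ → Pt → ℝ) (v : Fin 3 → ℝ → Pt → ℝ) : Prop :=
  ∀ t ∈ s, ∀ x, deriv (fun τ => ψ τ x) t + (∑ i, v i t x * pd i (ψ t) x) + v 2 t x = 0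

/-- Divergence-free condition on `s × ℝ³`. -/
def DivFree (s : Set ℝ) (v : Fin 3 → ℝ → Pt → ℝ) : Prop :=
  ∀ t ∈ s, ∀ x, (∑ i, pd i (fun y => v i t y) x) = 0

/-- The momentum equations of system (S) on `s × ℝ³`. -/
def MomentumEq (s : Set ℝ) (ψ : ℝ → Pt → ℝ) (v : Fin 3 → ℝ → Pt → ℝ)
    (p : ℝ → Pt → ℝ) : Prop :=
  ∀ j : Fin 3, ∀ t ∈ s, ∀ x,
    deriv (fun τ => v j τ x) t + (∑ i, v i t x * pd i (v j t) x) - lapl (v j t) x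
      + pd j (p t) x + pd j (pd 2 (ψ t)) x + (if j = 2 then lapl (ψ t) x else 0)
    = - ∑ i, pd i (fun y => pd j (ψ t) y * pd i (ψ t) y) x

/-- The full system (S) on `s × ℝ³`. -/
def SolvesS (s : Set ℝ) (ψ : ℝ → Pt → ℝ) (v : Fin 3 → ℝ → Pt → ℝ)
    (p : ℝ → Pt → ℝ) : Prop :=
  TransportEq s ψ v ∧ MomentumEq s ψ v p ∧ DivFree s v

/-- Finiteness of the four norms entering `B_T`. -/
def FiniteClass (T : ℝ) (ψ : ℝ → Pt → ℝ) (v : Fin 3 → ℝ → Pt → ℝ) : Prop :=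
  BddAbove ((fun t => Real.sqrt (vecHSq 2 fun j => v j t)) '' Icc 0 T) ∧
  BddAbove ((fun t => Real.sqrt (gradHSq 2 (ψ t))) '' Icc 0 T) ∧
  IntervalIntegrable (fun t => gradVecHSq 2 fun j => v j t) volume 0 T ∧
  IntervalIntegrable (fun t => gradHHSq 1 (ψ t)) volume 0 T

open scoped SchwartzMap LineDeriv Topology

/-- The Cauchy–Schwarz inequality for lower integrals. -/
lemma lintegral_mul_le_half {α : Type*} [MeasurableSpace α] {μ : Measure α} {f g : α → ℝ≥0∞}
    (hf : Measurable f) (hg : Measurable g) :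
    ∫⁻ x, f x * g x ∂μ ≤ (∫⁻ x, f x ^ 2 ∂μ) ^ (1 / 2 : ℝ) * (∫⁻ x, g x ^ 2 ∂μ) ^ (1 / 2 : ℝ) := by
  simpa using ENNReal.lintegral_mul_le_Lp_mul_Lq μ Real.HolderConjugate.two_two
    hf.aemeasurable hg.aemeasurable

/-- A two-dimensional Ladyzhenskaya inequality in abstract form. -/
lemma lintegral_pow_four_le_plane {u a b : ℝ × ℝ → ℝ≥0∞} (hu : Measurable u) (ha : Measurable a)
    (hb : Measurable b) (hua : ∀ x y, u (x, y) ^ 2 ≤ ∫⁻ s, u (s, y) * a (s, y))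
    (hub : ∀ x y, u (x, y) ^ 2 ≤ ∫⁻ s, u (x, s) * b (x, s)) :
    ∫⁻ p, u p ^ 4 ≤ (∫⁻ p, u p ^ 2) *
      ((∫⁻ p, a p ^ 2) ^ (1 / 2 : ℝ) * (∫⁻ p, b p ^ 2) ^ (1 / 2 : ℝ)) := by
  have hP : Measurable fun y => ∫⁻ s, u (s, y) * a (s, y) :=
    (hu.mul ha).lintegral_prod_left'
  have hQ : Measurable fun x => ∫⁻ s, u (x, s) * b (x, s) :=
    (hu.mul hb).lintegral_prod_right'
  calc ∫⁻ p, u p ^ 4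
      ≤ ∫⁻ p : ℝ × ℝ, (∫⁻ s, u (p.1, s) * b (p.1, s)) * (∫⁻ s, u (s, p.2) * a (s, p.2)) := by
        refine lintegral_mono fun p => ?_
        calc u p ^ 4 = u p ^ 2 * u p ^ 2 := by ring
          _ ≤ _ := mul_le_mul' (hub p.1 p.2) (hua p.1 p.2)
    _ = (∫⁻ p, u p * b p) * (∫⁻ p, u p * a p) := by
        rw [Measure.volume_eq_prod, lintegral_prod_mul hQ.aemeasurable hP.aemeasurable,
          lintegral_prod (fun p => u p * b p) (hu.mul hb).aemeasurable,
          lintegral_prod_symm (fun p => u p * a p) (hu.mul ha).aemeasurable]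
    _ ≤ ((∫⁻ p, u p ^ 2) ^ (1 / 2 : ℝ) * (∫⁻ p, b p ^ 2) ^ (1 / 2 : ℝ)) *
          ((∫⁻ p, u p ^ 2) ^ (1 / 2 : ℝ) * (∫⁻ p, a p ^ 2) ^ (1 / 2 : ℝ)) :=
        mul_le_mul' (lintegral_mul_le_half hu hb) (lintegral_mul_le_half hu ha)
    _ = (((∫⁻ p, u p ^ 2) ^ (1 / 2 : ℝ)) * ((∫⁻ p, u p ^ 2) ^ (1 / 2 : ℝ))) *
      ((∫⁻ p, a p ^ 2) ^ (1 / 2 : ℝ) * (∫⁻ p, b p ^ 2) ^ (1 / 2 : ℝ)) := by ring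
    _ = _ := by
        rw [← ENNReal.rpow_add_of_nonneg _ _ (by norm_num) (by norm_num)]
        norm_num

/-- The anisotropic `L⁴` bound in abstract form; the first variable plays the vertical role. -/
lemma lintegral_pow_four_le_space {u a b c : ℝ × ℝ × ℝ → ℝ≥0∞} (hu : Measurable u)
    (ha : Measurable a) (hb : Measurable b) (hc : Measurable c)
    (hua : ∀ z x y, u (z, x, y) ^ 2 ≤ ∫⁻ s, u (z, s, y) * a (z, s, y))
    (hub : ∀ z x y, u (z, x, y) ^ 2 ≤ ∫⁻ s, u (z, x, s) * b (z, x, s))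
    (huc : ∀ z x y, u (z, x, y) ^ 2 ≤ ∫⁻ s, u (s, x, y) * c (s, x, y)) :
    ∫⁻ q, u q ^ 4 ≤ ((∫⁻ q, u q ^ 2) ^ (1 / 2 : ℝ) * (∫⁻ q, c q ^ 2) ^ (1 / 2 : ℝ)) *
      ((∫⁻ q, a q ^ 2) ^ (1 / 2 : ℝ) * (∫⁻ q, b q ^ 2) ^ (1 / 2 : ℝ)) := by
  have hslice (z : ℝ) : ∫⁻ p, u (z, p) ^ 2 ≤
      (∫⁻ q, u q ^ 2) ^ (1 / 2 : ℝ) * (∫⁻ q, c q ^ 2) ^ (1 / 2 : ℝ) :=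
    calc ∫⁻ p, u (z, p) ^ 2 ≤ ∫⁻ p, ∫⁻ s, u (s, p) * c (s, p) :=
          lintegral_mono fun p => huc z p.1 p.2
      _ = ∫⁻ q, u q * c q := by
          rw [Measure.volume_eq_prod ℝ (ℝ × ℝ),
            lintegral_prod_symm (fun q => u q * c q) (hu.mul hc).aemeasurable]
      _ ≤ _ := lintegral_mul_le_half hu hc
  set K := (∫⁻ q, u q ^ 2) ^ (1 / 2 : ℝ) * (∫⁻ q, c q ^ 2) ^ (1 / 2 : ℝ)
  have hA : Measurable fun z => ∫⁻ p, a (z, p) ^ 2 := (ha.pow_const 2).lintegral_prod_right'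
  have hB : Measurable fun z => ∫⁻ p, b (z, p) ^ 2 := (hb.pow_const 2).lintegral_prod_right'
  calc ∫⁻ q, u q ^ 4 = ∫⁻ z, ∫⁻ p, u (z, p) ^ 4 := by
        rw [Measure.volume_eq_prod ℝ (ℝ × ℝ), lintegral_prod _ (hu.pow_const 4).aemeasurable]
    _ ≤ ∫⁻ z, K * ((∫⁻ p, a (z, p) ^ 2) ^ (1 / 2 : ℝ) * (∫⁻ p, b (z, p) ^ 2) ^ (1 / 2 : ℝ)) := by
        refine lintegral_mono fun z => ?_
        refine (lintegral_pow_four_le_plane (hu.comp measurable_prodMk_left)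
          (ha.comp measurable_prodMk_left) (hb.comp measurable_prodMk_left)
          (hua z) (hub z)).trans ?_
        exact mul_le_mul_left (hslice z) _
    _ = K * ∫⁻ z, (∫⁻ p, a (z, p) ^ 2) ^ (1 / 2 : ℝ) * (∫⁻ p, b (z, p) ^ 2) ^ (1 / 2 : ℝ) :=
        lintegral_const_mul _ ((hA.pow_const _).mul (hB.pow_const _))
    _ ≤ K * ((∫⁻ z, ∫⁻ p, a (z, p) ^ 2) ^ (1 / 2 : ℝ) *
          (∫⁻ z, ∫⁻ p, b (z, p) ^ 2) ^ (1 / 2 : ℝ)) := by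
        gcongr
        exact ENNReal.lintegral_mul_norm_pow_le hA.aemeasurable hB.aemeasurable
          (by norm_num) (by norm_num) (by norm_num)
    _ = _ := by
        rw [Measure.volume_eq_prod ℝ (ℝ × ℝ), lintegral_prod _ (ha.pow_const 2).aemeasurable,
          lintegral_prod _ (hb.pow_const 2).aemeasurable]

/-- Coordinates on `ℝ³` with the vertical one first. -/
def vertFirst (q : ℝ × ℝ × ℝ) : Pt := ![q.2.1, q.2.2, q.1]

lemma measurePreserving_vertFirst : MeasurePreserving vertFirst := by
  have h1 := (volume_preserving_piFinSuccAbove (fun _ : Fin 3 => ℝ) 2).symm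
  have h2 := (volume_preserving_finTwoArrow ℝ).symm
  have h3 := h1.comp ((MeasurePreserving.id (volume : Measure ℝ)).prod h2)
  convert h3 using 1
  · ext q i
    fin_cases i <;> rfl
  · exact Measure.volume_eq_prod _ _

lemma lintegral_comp_vertFirst {F : Pt → ℝ≥0∞} (hF : Measurable F) :
    ∫⁻ q, F (vertFirst q) = ∫⁻ x, F x :=
  measurePreserving_vertFirst.lintegral_comp hF

lemma vertFirst_horizontal_fst (z x y : ℝ) :
    vertFirst (z, x, y) = vertFirst (z, 0, y) + x • Pi.single 0 1 := by
  ext i; fin_cases i <;> simp [vertFirst]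

lemma vertFirst_horizontal_snd (z x y : ℝ) :
    vertFirst (z, x, y) = vertFirst (z, x, 0) + y • Pi.single 1 1 := by
  ext i; fin_cases i <;> simp [vertFirst]

lemma vertFirst_vertical (z x y : ℝ) :
    vertFirst (z, x, y) = vertFirst (0, x, y) + z • Pi.single 2 1 := by
  ext i; fin_cases i <;> simp [vertFirst]

/-- A function vanishing at `-∞` is bounded by the total variation of its derivative. -/
lemma enorm_le_lintegral_enorm_of_hasDerivAt {g g' : ℝ → ℝ} (hg : ∀ t, HasDerivAt g (g' t) t)
    (hg' : Continuous g') (h0 : Tendsto g atBot (𝓝 0)) (t : ℝ) : ‖g t‖ₑ ≤ ∫⁻ s, ‖g' s‖ₑ := by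
  by_cases hfin : ∫⁻ s, ‖g' s‖ₑ = ⊤
  · simp [hfin]
  have hint : Integrable g' := ⟨hg'.aestronglyMeasurable, lt_top_iff_ne_top.2 hfin⟩
  have := integral_Iic_of_hasDerivAt_of_tendsto' (fun x _ => hg x)
    (hint.integrableOn (s := Iic t)) h0
  rw [sub_zero] at this
  rw [← this]
  exact (enorm_integral_le_lintegral_enorm _).trans (setLIntegral_le_lintegral _ _)

/-- A partial derivative of a Schwartz function is again a Schwartz function. -/
lemma pd_coe (i : Fin 3) (f : 𝓢(Pt, ℝ)) : pd i f = (∂_{(Pi.single i 1 : Pt)} f : 𝓢(Pt, ℝ)) := by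
  ext x
  rw [SchwartzMap.lineDerivOp_apply_eq_fderiv]
  rfl

lemma pd_comm (i j : Fin 3) (f : 𝓢(Pt, ℝ)) : pd i (pd j f) = pd j (pd i f) := by
  have key (k l : Fin 3) (x : Pt) : pd k (pd l f) x =
      fderiv ℝ (fderiv ℝ f) x (Pi.single k 1) (Pi.single l 1) := by
    have hd : DifferentiableAt ℝ (fderiv ℝ f) x :=
      ((f.smooth 2).fderiv_right (m := 1) (by norm_num)).differentiable (by norm_num) x
    unfold pd
    rw [fderiv_clm_apply hd (differentiableAt_const _)]
    simp
  ext x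
  rw [key, key]
  exact ((f.smooth 2).contDiffAt.isSymmSndFDerivAt (by simp)).eq _ _

lemma tendsto_schwartz_line (f : 𝓢(Pt, ℝ)) (x : Pt) (i : Fin 3) :
    Tendsto (fun t : ℝ => f (x + t • Pi.single i 1)) atBot (𝓝 0) := by
  refine (zero_at_infty f).comp ?_
  rw [← Metric.cobounded_eq_cocompact, ← tendsto_norm_atTop_iff_cobounded]
  have h : Tendsto (fun t : ℝ => |x i + t|) atBot atTop :=
    tendsto_abs_atBot_atTop.comp (tendsto_atBot_add_const_left _ _ tendsto_id)
  refine tendsto_atTop_mono (fun t => ?_) h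
  simpa using norm_le_pi_norm (x + t • (Pi.single i 1 : Pt)) i

lemma enorm_sq_le_lintegral_line (f : 𝓢(Pt, ℝ)) (x : Pt) (i : Fin 3) (t : ℝ) :
    ‖f (x + t • Pi.single i 1)‖ₑ ^ 2 ≤
      ∫⁻ s : ℝ, ‖f (x + s • Pi.single i 1)‖ₑ * ‖2 * pd i f (x + s • Pi.single i 1)‖ₑ := by
  have hline (s : ℝ) : HasDerivAt (fun s : ℝ => x + s • (Pi.single i 1 : Pt)) (Pi.single i 1) s := by
    simpa using ((hasDerivAt_id s).smul_const (Pi.single i 1 : Pt)).const_add x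
  have hf (s : ℝ) : HasDerivAt (fun s : ℝ => f (x + s • (Pi.single i 1 : Pt)))
      (pd i f (x + s • Pi.single i 1)) s :=
    (f.differentiableAt.hasFDerivAt).comp_hasDerivAt s (hline s)
  have hcont : Continuous fun s : ℝ => pd i f (x + s • Pi.single i 1) := by
    rw [pd_coe]
    exact (SchwartzMap.continuous _).comp (by fun_prop)
  have hcont' : Continuous fun s : ℝ => f (x + s • Pi.single i 1) :=
    f.continuous.comp (by fun_prop)
  have := enorm_le_lintegral_enorm_of_hasDerivAt
    (g := fun s => f (x + s • Pi.single i 1) ^ 2)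
    (g' := fun s => f (x + s • Pi.single i 1) * (2 * pd i f (x + s • Pi.single i 1)))
    (fun s => ((hf s).pow 2).congr_deriv (by push_cast; ring)) (by fun_prop)
    (by simpa using (tendsto_schwartz_line f x i).pow 2) t
  simpa only [enorm_pow, enorm_mul] using this

lemma integrable_schwartz_pow (f : 𝓢(Pt, ℝ)) {n : ℕ} (hn : Even n) (hn0 : n ≠ 0) :
    Integrable fun x => f x ^ n := by
  simpa [hn.pow_abs] using (f.memLp (n : ℝ≥0∞)).integrable_norm_pow hn0

lemma lintegral_enorm_pow (f : 𝓢(Pt, ℝ)) {n : ℕ} (hn : Even n) (hn0 : n ≠ 0) :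
    ∫⁻ x, ‖f x‖ₑ ^ n = ENNReal.ofReal (∫ x, f x ^ n) := by
  rw [ofReal_integral_eq_lintegral_ofReal (integrable_schwartz_pow f hn hn0)
    (ae_of_all _ fun x => hn.pow_nonneg _)]
  refine lintegral_congr fun x => ?_
  rw [← enorm_pow, Real.enorm_eq_ofReal (hn.pow_nonneg _)]

/-- The anisotropic bound `‖f‖_{L⁴}⁴ ≤ 8 ‖f‖ ‖∂₃f‖ ‖∂₁f‖ ‖∂₂f‖` (norms in `L²`), with common bounds
`S` for `‖f‖²`, `‖∂₃f‖²` and `H` for `‖∂₁f‖²`, `‖∂₂f‖²`. -/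
lemma integral_pow_four_le (f : 𝓢(Pt, ℝ)) {S H : ℝ} (hS : 0 ≤ S) (hH : 0 ≤ H)
    (hf : ∫ x, f x ^ 2 ≤ S) (hf2 : ∫ x, pd 2 f x ^ 2 ≤ S)
    (hf0 : ∫ x, pd 0 f x ^ 2 ≤ H) (hf1 : ∫ x, pd 1 f x ^ 2 ≤ H) :
    ∫ x, f x ^ 4 ≤ 8 * S * H := by
  have hm : Measurable vertFirst := measurePreserving_vertFirst.measurable
  have hmu : Measurable fun x => ‖f x‖ₑ := f.continuous.measurable.enorm
  have hpd (i : Fin 3) : Measurable fun x => ‖2 * pd i f x‖ₑ := by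
    rw [pd_coe]
    exact ((SchwartzMap.continuous _).measurable.const_mul 2).enorm
  have hfold (i : Fin 3) {B : ℝ} (hB : ∫ x, pd i f x ^ 2 ≤ B) :
      ∫⁻ q, ‖2 * pd i f (vertFirst q)‖ₑ ^ 2 ≤ ENNReal.ofReal (4 * B) := by
    rw [lintegral_comp_vertFirst ((hpd i).pow_const 2)]
    have h2 (x : Pt) : ‖2 * pd i f x‖ₑ ^ 2 = 4 * ‖pd i f x‖ₑ ^ 2 := by
      rw [enorm_mul, mul_pow, Real.enorm_eq_ofReal zero_le_two]
      norm_num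
    simp_rw [h2]
    rw [lintegral_const_mul' _ _ (by simp), ENNReal.ofReal_mul (by norm_num)]
    rw [pd_coe] at hB ⊢
    rw [lintegral_enorm_pow _ even_two two_ne_zero]
    gcongr
    simp
  have key := lintegral_pow_four_le_space (hmu.comp hm) ((hpd 0).comp hm) ((hpd 1).comp hm)
    ((hpd 2).comp hm)
    (fun z x y => by
      simpa only [Function.comp_apply, ← vertFirst_horizontal_fst] using
        enorm_sq_le_lintegral_line f (vertFirst (z, 0, y)) 0 x)
    (fun z x y => by
      simpa only [Function.comp_apply, ← vertFirst_horizontal_snd] using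
        enorm_sq_le_lintegral_line f (vertFirst (z, x, 0)) 1 y)
    (fun z x y => by
      simpa only [Function.comp_apply, ← vertFirst_vertical] using
        enorm_sq_le_lintegral_line f (vertFirst (0, x, y)) 2 z)
  simp only [Function.comp_apply] at key
  rw [lintegral_comp_vertFirst (hmu.pow_const 4), lintegral_comp_vertFirst (hmu.pow_const 2),
    lintegral_enorm_pow f (by decide) (by norm_num),
    lintegral_enorm_pow f even_two two_ne_zero] at key
  have hle := key.trans (mul_le_mul'
    (mul_le_mul' (ENNReal.rpow_le_rpow (ENNReal.ofReal_le_ofReal hf) (by norm_num))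
      (ENNReal.rpow_le_rpow (hfold 2 hf2) (by norm_num)))
    (mul_le_mul' (ENNReal.rpow_le_rpow (hfold 0 hf0) (by norm_num))
      (ENNReal.rpow_le_rpow (hfold 1 hf1) (by norm_num))))
  simp only [ENNReal.ofReal_rpow_of_nonneg hS (show (0 : ℝ) ≤ 1 / 2 by norm_num),
    ENNReal.ofReal_rpow_of_nonneg (mul_nonneg zero_le_four hS) (show (0 : ℝ) ≤ 1 / 2 by norm_num),
    ENNReal.ofReal_rpow_of_nonneg (mul_nonneg zero_le_four hH) (show (0 : ℝ) ≤ 1 / 2 by norm_num),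
    ← Real.sqrt_eq_rpow] at hle
  rw [← ENNReal.ofReal_mul (by positivity), ← ENNReal.ofReal_mul (by positivity),
    ← ENNReal.ofReal_mul (by positivity), ENNReal.ofReal_le_ofReal_iff (by positivity)] at hle
  refine hle.trans_eq ?_
  rw [Real.mul_self_sqrt (by positivity), Real.sqrt_mul zero_le_four,
    show √(4 : ℝ) = 2 by rw [show (4 : ℝ) = 2 ^ 2 by norm_num]; exact Real.sqrt_sq zero_le_two]
  linear_combination (8 * H) * Real.mul_self_sqrt hS

lemma integral_sq_pdM_le {k : ℕ} {α : Fin 3 → ℕ} (hα : α ∈ midx k) (f : Pt → ℝ) :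
    ∫ x, pdM α f x ^ 2 ≤ hSq k f := by
  simp_rw [sq]
  exact Finset.single_le_sum (f := fun α => ∫ x, pdM α f x * pdM α f x)
    (fun β _ => integral_nonneg fun x => mul_self_nonneg _) hα

lemma hSq_nonneg (k : ℕ) (f : Pt → ℝ) : 0 ≤ hSq k f :=
  Finset.sum_nonneg fun _ _ => integral_nonneg fun _ => mul_self_nonneg _

lemma gradHSq_nonneg (k : ℕ) (f : Pt → ℝ) : 0 ≤ gradHSq k f :=
  Finset.sum_nonneg fun _ _ => hSq_nonneg _ _

lemma gradHHSq_nonneg (k : ℕ) (f : Pt → ℝ) : 0 ≤ gradHHSq k f :=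
  Finset.sum_nonneg fun _ _ => Finset.sum_nonneg fun _ _ => hSq_nonneg _ _

lemma hSq_pd_le_gradHSq (k : ℕ) (j : Fin 3) (f : Pt → ℝ) : hSq k (pd j f) ≤ gradHSq k f :=
  Finset.single_le_sum (f := fun j => hSq k (pd j f)) (fun _ _ => hSq_nonneg _ _)
    (Finset.mem_univ j)

lemma hSq_pd_pd_le_gradHHSq (k : ℕ) {i : Fin 3} (hi : i ∈ hIdx) (j : Fin 3) (f : Pt → ℝ) :
    hSq k (pd i (pd j f)) ≤ gradHHSq k f :=
  (Finset.single_le_sum (f := fun j => hSq k (pd i (pd j f))) (fun _ _ => hSq_nonneg _ _)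
    (Finset.mem_univ j)).trans
  (Finset.single_le_sum (f := fun i => ∑ j, hSq k (pd i (pd j f)))
    (fun _ _ => Finset.sum_nonneg fun _ _ => hSq_nonneg _ _) hi)

lemma integral_sq_pd_le (i : Fin 3) {k : ℕ} (hk : 1 ≤ k) (f : Pt → ℝ) :
    ∫ x, pd i f x ^ 2 ≤ hSq k f := by
  have hα : (Pi.single i 1 : Fin 3 → ℕ) ∈ midx k := by
    simp only [midx, Finset.mem_filter, Fintype.mem_piFinset, Finset.mem_range]
    refine ⟨fun l => ?_, by simpa using hk⟩
    have : (Pi.single i 1 : Fin 3 → ℕ) l ≤ 1 := by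
      rw [Pi.single_apply]; split_ifs <;> simp
    lia
  have h := integral_sq_pdM_le hα f
  have e : pdM (Pi.single i 1) f = pd i f := by
    fin_cases i <;> simp [pdM]
  rwa [e] at h

lemma integral_sq_pd_pd_vert_le (i : Fin 3) (f : Pt → ℝ) :
    ∫ x, pd i (pd 2 f) x ^ 2 ≤ hSq 2 f := by
  have hα : (Pi.single i 1 + Pi.single 2 1 : Fin 3 → ℕ) ∈ midx 2 := by
    fin_cases i <;> decide
  have h := integral_sq_pdM_le hα f
  have e : pdM (Pi.single i 1 + Pi.single 2 1) f = pd i (pd 2 f) := by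
    fin_cases i <;> simp [pdM]
  rwa [e] at h

/-- The inequality at a fixed time. -/
lemma integral_hessian_sq_sq_le (f : 𝓢(Pt, ℝ)) :
    ∫ x, (∑ i, ∑ j, (pd i (pd j f) x) ^ 2) ^ 2 ≤ 648 * gradHSq 2 f * gradHHSq 1 f := by
  have hentry (p : Fin 3 × Fin 3) : Integrable (fun x => pd p.1 (pd p.2 f) x ^ 4) ∧
      ∫ x, pd p.1 (pd p.2 f) x ^ 4 ≤ 8 * gradHSq 2 f * gradHHSq 1 f := by
    obtain ⟨i, j⟩ := p
    have hcoe : pd i (pd j f) =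
        (∂_{(Pi.single i 1 : Pt)} (∂_{(Pi.single j 1 : Pt)} f) : 𝓢(Pt, ℝ)) := by
      rw [pd_coe, pd_coe]
    have hcomm (k : Fin 3) : pd k (pd i (pd j f)) = pd i (pd k (pd j f)) := by
      rw [pd_coe j, pd_comm]
    have hhor {k : Fin 3} (hk : k ∈ hIdx) :
        ∫ x, pd k (pd i (pd j f)) x ^ 2 ≤ gradHHSq 1 f := by
      rw [hcomm]
      exact (integral_sq_pd_le i le_rfl _).trans (hSq_pd_pd_le_gradHHSq 1 hk j f)
    have hlow := (integral_sq_pd_le i one_le_two (pd j f)).trans (hSq_pd_le_gradHSq 2 j f)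
    have hvert : ∫ x, pd 2 (pd i (pd j f)) x ^ 2 ≤ gradHSq 2 f := by
      rw [hcomm]
      exact (integral_sq_pd_pd_vert_le i _).trans (hSq_pd_le_gradHSq 2 j f)
    have h0 := hhor (k := 0) (by decide)
    have h1 := hhor (k := 1) (by decide)
    dsimp only
    rw [hcoe] at hlow hvert h0 h1 ⊢
    exact ⟨integrable_schwartz_pow _ (by decide) (by norm_num),
      integral_pow_four_le _ (gradHSq_nonneg 2 f) (gradHHSq_nonneg 1 f) hlow hvert h0 h1⟩
  calc ∫ x, (∑ i, ∑ j, (pd i (pd j f) x) ^ 2) ^ 2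
      ≤ ∫ x, 9 * ∑ p : Fin 3 × Fin 3, pd p.1 (pd p.2 f) x ^ 4 := by
        refine integral_mono_of_nonneg (ae_of_all _ fun x => sq_nonneg _)
          ((integrable_finsetSum _ fun p _ => (hentry p).1).const_mul 9) (ae_of_all _ fun x => ?_)
        have := sq_sum_le_card_mul_sum_sq (s := Finset.univ)
          (f := fun p : Fin 3 × Fin 3 => pd p.1 (pd p.2 f) x ^ 2)
        simpa [← Fintype.sum_prod_type', ← pow_mul] using this
    _ = 9 * ∑ p : Fin 3 × Fin 3, ∫ x, pd p.1 (pd p.2 f) x ^ 4 := by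
        rw [integral_const_mul, integral_finsetSum _ fun p _ => (hentry p).1]
    _ ≤ 9 * ∑ p : Fin 3 × Fin 3, 8 * gradHSq 2 f * gradHHSq 1 f := by
        gcongr with p
        exact (hentry p).2
    _ = _ := by
        simp
        ring

/-- Lemma 2.2, second inequality:
`‖∇²ψ‖_{L⁴_T(L⁴)} ≤ C ‖∇_h∇ψ‖_{L²_T(H¹)}^{1/2} ‖∇ψ‖_{L^∞_T(H²)}^{1/2}`. -/
theorem stmt_2 :
    ∃ C : ℝ, 0 < C ∧ ∀ T : ℝ, 0 < T → ∀ ψ : ℝ → Pt → ℝ,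
      SmoothOn2 (Icc 0 T) ψ → (∀ t ∈ Icc (0:ℝ) T, IsSchwartz (ψ t)) →
      BddAbove ((fun t => Real.sqrt (gradHSq 2 (ψ t))) '' Icc 0 T) →
      IntervalIntegrable (fun t => gradHHSq 1 (ψ t)) volume 0 T →
      l4T T (fun t => (∫ x : Pt, (∑ i, ∑ j, (pd i (pd j (ψ t)) x) ^ 2) ^ 2) ^ ((1:ℝ)/4)) ≤
        C * (l2T T fun t => Real.sqrt (gradHHSq 1 (ψ t))) ^ ((1:ℝ)/2)
          * (supT T fun t => Real.sqrt (gradHSq 2 (ψ t))) ^ ((1:ℝ)/2) := by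

  refine ⟨6, by norm_num, fun T hT ψ _ hψ hbdd hint => ?_⟩
  set M := supT T fun t => Real.sqrt (gradHSq 2 (ψ t))
  have hM (t : ℝ) (ht : t ∈ Icc 0 T) : √(gradHSq 2 (ψ t)) ≤ M := le_csSup hbdd ⟨t, ht, rfl⟩
  have hM0 : 0 ≤ M := (Real.sqrt_nonneg _).trans (hM 0 ⟨le_rfl, hT.le⟩)
  have hI0 : 0 ≤ ∫ t in (0 : ℝ)..T, gradHHSq 1 (ψ t) :=
    intervalIntegral.integral_nonneg hT.le fun t _ => gradHHSq_nonneg 1 _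
  have hpt (t : ℝ) (ht : t ∈ Icc 0 T) :
      ((∫ x : Pt, (∑ i, ∑ j, (pd i (pd j (ψ t)) x) ^ 2) ^ 2) ^ ((1 : ℝ) / 4)) ^ 4 ≤
        648 * M ^ 2 * gradHHSq 1 (ψ t) := by
    rw [← Real.rpow_natCast, ← Real.rpow_mul (integral_nonneg fun x => sq_nonneg _)]
    norm_num
    refine (integral_hessian_sq_sq_le ⟨ψ t, (hψ t ht).1, (hψ t ht).2⟩).trans ?_
    have := gradHHSq_nonneg 1 (ψ t)
    change 648 * gradHSq 2 (ψ t) * gradHHSq 1 (ψ t) ≤ _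
    gcongr
    rw [← Real.sq_sqrt (gradHSq_nonneg 2 (ψ t))]
    exact pow_le_pow_left₀ (Real.sqrt_nonneg _) (hM t ht) 2
  have htime : ∫ t in (0 : ℝ)..T,
      ((∫ x : Pt, (∑ i, ∑ j, (pd i (pd j (ψ t)) x) ^ 2) ^ 2) ^ ((1 : ℝ) / 4)) ^ 4 ≤
        648 * M ^ 2 * ∫ t in (0 : ℝ)..T, gradHHSq 1 (ψ t) := by
    rw [← intervalIntegral.integral_const_mul, intervalIntegral.integral_of_le hT.le,
      intervalIntegral.integral_of_le hT.le]
    refine integral_mono_of_nonneg (ae_of_all _ fun t => Even.pow_nonneg (by decide) _)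
      ((hint.const_mul _).1) ?_
    filter_upwards [ae_restrict_mem measurableSet_Ioc] with t ht
    exact hpt t (Ioc_subset_Icc_self ht)
  have hl2 : l2T T (fun t => √(gradHHSq 1 (ψ t))) = √(∫ t in (0 : ℝ)..T, gradHHSq 1 (ψ t)) := by
    simp only [l2T, Real.sq_sqrt (gradHHSq_nonneg 1 _)]
  rw [hl2]
  set J := ∫ t in (0 : ℝ)..T, gradHHSq 1 (ψ t)
  refine (Real.rpow_le_rpow (intervalIntegral.integral_nonneg hT.le
    fun t _ => Even.pow_nonneg (by decide) _) htime (by norm_num)).trans ?_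
  calc (648 * M ^ 2 * J) ^ ((1 : ℝ) / 4)
      ≤ ((6 * (√J) ^ ((1 : ℝ) / 2) * M ^ ((1 : ℝ) / 2)) ^ 4) ^ ((1 : ℝ) / 4) := by
        refine Real.rpow_le_rpow (by positivity) ?_ (by norm_num)
        have hhalf {y : ℝ} (hy : 0 ≤ y) : (y ^ ((1 : ℝ) / 2)) ^ 4 = y ^ 2 := by
          rw [← Real.sqrt_eq_rpow, show 4 = 2 * 2 by rfl, pow_mul, Real.sq_sqrt hy]
        rw [mul_pow, mul_pow, hhalf (Real.sqrt_nonneg _), hhalf hM0, Real.sq_sqrt hI0]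
        nlinarith [mul_nonneg hI0 (sq_nonneg M)]
    _ = _ := by
        rw [← Real.rpow_natCast, ← Real.rpow_mul (by positivity)]
        norm_num

end
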